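/- Let n ≥ 4. The identities of the stylic monoid Styl_n admit no finite basis: for every finite set Δ of monoid identities each of which holds in Styl_n, there exists an identity w = w' that holds in Styl_n but does not follow from Δ, i.e., some monoid satisfies all identities of Δ but fails w = w'. -/

import Mathlib

/-- Defining relations of the stylic monoid `Styl_n` (Abram–Reutenauer presentation):
`a_i² = a_i`; `a_j a_i a_k = a_j a_k a_i` and `a_i a_k a_j = a_k a_i a_j` for `i < j < k`;
`a_j a_i a_i = a_i a_j a_i` and `a_j a_j a_i = a_j a_i a_j` for `i < j`. -/
def stylRel (n : ℕ) : FreeMonoid (Fin n) → FreeMonoid (Fin n) → Prop := fun u v =>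
  (∃ i : Fin n, u = .of i * .of i ∧ v = .of i) ∨
  (∃ i j k : Fin n, i < j ∧ j < k ∧ u = .of j * .of i * .of k ∧ v = .of j * .of k * .of i) ∨
  (∃ i j k : Fin n, i < j ∧ j < k ∧ u = .of i * .of k * .of j ∧ v = .of k * .of i * .of j) ∨
  (∃ i j : Fin n, i < j ∧ u = .of j * .of i * .of i ∧ v = .of i * .of j * .of i) ∨
  (∃ i j : Fin n, i < j ∧ u = .of j * .of j * .of i ∧ v = .of j * .of i * .of j)

/-- The stylic monoid on `n` generators. -/
abbrev Styl (n : ℕ) := PresentedMonoid (stylRel n)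

/-- The `i`-th generator of the stylic monoid. -/
def stylGen (n : ℕ) (i : Fin n) : Styl n := PresentedMonoid.of (stylRel n) i

/-- every subword of length at most `n` of `l` is a subword of `l'`. -/
def SubLe {α : Type*} (n : ℕ) (l l' : List α) : Prop :=
  ∀ s : List α, s.length ≤ n → s.Sublist l → s.Sublist l'

def stepF (k : ℕ) : Function.End ℕ := fun s => if s = k then s + 1 else s

lemma stepF_apply (k s : ℕ) : stepF k s = if s = k then s + 1 else s := rfl

lemma mulEnd (f g : Function.End ℕ) (s : ℕ) : (f * g) s = f (g s) := rfl

def stylAct (n : ℕ) : Styl n →* Function.End ℕ :=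
  PresentedMonoid.lift (rels := stylRel n) (fun k : Fin n => stepF k.val) (by
    intro u v h
    rcases h with ⟨i, rfl, rfl⟩ | ⟨i, j, k, hij, hjk, rfl, rfl⟩ | ⟨i, j, k, hij, hjk, rfl, rfl⟩ |
      ⟨i, j, hij, rfl, rfl⟩ | ⟨i, j, hij, rfl, rfl⟩ <;>
    simp only [map_mul, FreeMonoid.lift_eval_of] <;>
    · funext s
      simp only [mulEnd, stepF_apply, Fin.lt_def] at *
      split_ifs <;> omega)

lemma stylAct_gen (n : ℕ) (k : Fin n) : stylAct n (stylGen n k) = stepF k.val :=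
  PresentedMonoid.lift_of ..

lemma prod_stepF (ks : List ℕ) (h : ks.Pairwise (· < ·)) (s : ℕ) :
    (ks.map stepF).prod s = if s ∈ ks then s + 1 else s := by
  induction ks with
  | nil => simp; rfl
  | cons k ks ih =>
    rw [List.pairwise_cons] at h
    simp only [List.map_cons, List.prod_cons, mulEnd, ih h.2, stepF_apply, List.mem_cons]
    by_cases hs : s ∈ ks
    · have := h.1 s hs
      simp [hs]; omega
    · simp [hs]

def greedy {α : Type*} [DecidableEq α] (rs : List α) (y : α) (k : ℕ) : ℕ :=
  if rs[k]? = some y then k + 1 else k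

lemma greedy_iff {α : Type*} [DecidableEq α] (rs : List α) (l : List α) :
    ∀ k ≤ rs.length, k ≤ l.foldr (greedy rs) 0 ↔ ((rs.take k).reverse).Sublist l := by
  induction l with
  | nil =>
    intro k hk
    cases rs <;> cases k <;> simp_all
  | cons y l ih =>
    intro k hk
    cases k with
    | zero => simp
    | succ k =>
      have hk' : k < rs.length := hk
      have h1 := ih k (by omega)
      have h2 := ih (k+1) hk
      have e : (rs.take (k+1)).reverse = rs[k] :: (rs.take k).reverse := by
        rw [List.take_succ_eq_append_getElem hk']; simp
      rw [e] at h2 ⊢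
      rw [List.foldr_cons, greedy]
      generalize l.foldr (greedy rs) 0 = t at *
      constructor
      · intro h
        by_cases hkt : k + 1 ≤ t
        · exact (h2.1 hkt).trans (List.sublist_cons_self _ _)
        · split_ifs at h with hy
          · have : t = k := by omega
            subst this
            rw [List.getElem?_eq_getElem hk'] at hy
            simp only [Option.some.injEq] at hy
            rw [hy]
            exact (h1.1 le_rfl).cons_cons _
          · omega
      · intro h
        cases h with
        | cons _ h => have := h2.2 h; split_ifs <;> omega
        | cons_cons _ h =>
          have := h1.2 h
          rcases this.eq_or_lt with rfl | h3
          · rw [List.getElem?_eq_getElem hk']; simp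
          · split_ifs <;> omega

lemma subLe_of_identity (n : ℕ) {X : Type} (p q : FreeMonoid X)
    (h : ∀ φ : FreeMonoid X →* Styl n, φ p = φ q) : SubLe n p.toList q.toList := by
  classical
  intro s hs hsp
  let rs := s.reverse
  have hrs : rs.length ≤ n := by simpa [rs] using hs
  let φ : FreeMonoid X →* Styl n := FreeMonoid.lift fun y =>
    (((List.finRange n).filter (fun k => rs[k.val]? = some y)).map (stylGen n)).prod
  have key : ∀ y k, stylAct n (φ (FreeMonoid.of y)) k = greedy rs y k := by
    intro y k
    have : stylAct n (φ (FreeMonoid.of y)) =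
      ((((List.finRange n).filter (fun k => rs[k.val]? = some y)).map Fin.val).map stepF).prod := by
      simp only [φ, FreeMonoid.lift_eval_of, map_list_prod, List.map_map]
      rfl
    rw [this, prod_stepF]
    · unfold greedy
      congr 1
      simp only [List.mem_map, List.mem_filter, List.mem_finRange, true_and, decide_eq_true_eq,
        eq_iff_iff]
      constructor
      · rintro ⟨a, ha, rfl⟩; exact ha
      · intro hk
        have : k < rs.length := by
          by_contra hc
          rw [List.getElem?_eq_none (by omega)] at hk
          simp at hk
        exact ⟨⟨k, by omega⟩, hk, rfl⟩
    · rw [List.pairwise_map]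
      exact (List.pairwise_lt_finRange n).filter _
  have key2 : ∀ l : List X, stylAct n (φ (FreeMonoid.ofList l)) 0 = l.foldr (greedy rs) 0 := by
    intro l
    induction l with
    | nil => simp; rfl
    | cons y l ih =>
      rw [FreeMonoid.ofList_cons, map_mul, map_mul, mulEnd, ih, key, List.foldr_cons]
  have e : p.toList.foldr (greedy rs) 0 = q.toList.foldr (greedy rs) 0 := by
    rw [← key2, ← key2]
    simp [h φ]
  have h1 := greedy_iff rs p.toList rs.length le_rfl
  have h2 := greedy_iff rs q.toList rs.length le_rfl
  rw [List.take_length, List.reverse_reverse] at h1 h2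
  exact h2.1 (e ▸ h1.2 hsp)
/-! ### Insertions in the stylic monoid -/

lemma claimL_aux {M : Type*} [Monoid M] {n : ℕ} (g : Fin n → M) (h1 : ∀ i, g i * g i = g i)
    (h2 : ∀ i j, i < j → g j * g i * g j = g j * g i) :
    ∀ d : ℕ, ∀ m : Fin n, n - m.val ≤ d → ∀ U : List (Fin n),
      (∀ s : List (Fin n), s.Pairwise (· > ·) → (∀ y ∈ s, m < y) → s.Sublist U →
        (s ++ [m]).Sublist U) → (U.map g).prod * g m = (U.map g).prod := by
  intro d
  induction d with
  | zero => intro m hm; omega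
  | succ d ihd =>
    intro m hm U hU
    have inner : ∀ U2 U1 : List (Fin n),
        (∀ s : List (Fin n), s.Pairwise (· > ·) → (∀ y ∈ s, m < y) →
          s.Sublist (U1 ++ m :: U2) → s.Sublist U1) →
        ((U1 ++ m :: U2).map g).prod * g m = ((U1 ++ m :: U2).map g).prod := by
      intro U2
      induction U2 using List.reverseRecOn with
      | nil => intro U1 _; simp [mul_assoc, h1]
      | append_singleton U3 k ih =>
        intro U1 H
        have hsub : (U1 ++ m :: U3).Sublist (U1 ++ m :: (U3 ++ [k])) := by simp
        have ihQ := ih U1 (fun s a b c => H s a b (c.trans hsub))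
        have e : ((U1 ++ m :: (U3 ++ [k])).map g).prod = ((U1 ++ m :: U3).map g).prod * g k := by
          simp [mul_assoc]
        rw [e]
        set Q := ((U1 ++ m :: U3).map g).prod with hQ
        rcases lt_trichotomy k m with hk | hk | hk
        · calc Q * g k * g m = Q * g m * g k * g m := by rw [ihQ]
            _ = Q * (g m * g k * g m) := by simp only [mul_assoc]
            _ = Q * g m * g k := by rw [h2 k m hk]; simp only [mul_assoc]
            _ = Q * g k := by rw [ihQ]
        · subst hk; rw [mul_assoc, h1]
        · have : Q * g k = Q := by
            apply ihd k (by omega)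
            intro s hs hsk hsub'
            have : (s ++ [k]).Sublist U1 := by
              apply H
              · rw [List.pairwise_append]
                refine ⟨hs, by simp, ?_⟩
                intro a ha b hb
                simp only [List.mem_singleton] at hb
                subst hb; exact hsk a ha
              · intro y hy
                rw [List.mem_append, List.mem_singleton] at hy
                rcases hy with hy | rfl
                · exact hk.trans (hsk y hy)
                · exact hk
              · have := hsub'.append (List.Sublist.refl [k])
                simpa using this
            exact this.trans (List.sublist_append_left _ _)
          rw [this, ihQ]
    have hm' : m ∈ U.reverse := by
      have := hU [] List.Pairwise.nil (by simp) (by simp)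
      simpa using this
    obtain ⟨R2, R1, hR, hn⟩ := List.eq_append_cons_of_mem hm'
    have hUe : U = R1.reverse ++ m :: R2.reverse := by
      have := congrArg List.reverse hR
      simpa using this
    rw [hUe]
    apply inner
    intro s hs hsm hsub
    rw [← hUe] at hsub
    have h3 := hU s hs hsm hsub
    have h4 := h3.reverse
    rw [hR] at h4
    simp only [List.reverse_append, List.reverse_cons, List.reverse_nil, List.nil_append,
      List.cons_append] at h4
    have h5 : ∀ R : List (Fin n), m ∉ R → (m :: s.reverse).Sublist (R ++ m :: R1) →
        s.reverse.Sublist R1 := by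
      intro R
      induction R with
      | nil => intro _ h; exact (List.cons_sublist_cons.1 h)
      | cons c R ih =>
        intro hc h
        simp only [List.mem_cons, not_or] at hc
        cases h with
        | cons _ h => exact ih hc.2 h
        | cons_cons _ h => exact absurd rfl hc.1
    have := (h5 R2 hn h4).reverse
    simpa using this

lemma claimL {M : Type*} [Monoid M] {n : ℕ} (g : Fin n → M) (h1 : ∀ i, g i * g i = g i)
    (h2 : ∀ i j, i < j → g j * g i * g j = g j * g i) (m : Fin n) (U : List (Fin n))
    (hU : ∀ s : List (Fin n), s.Pairwise (· > ·) → (∀ y ∈ s, m < y) → s.Sublist U →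
        (s ++ [m]).Sublist U) : (U.map g).prod * g m = (U.map g).prod :=
  claimL_aux g h1 h2 _ m le_rfl U hU

lemma claimR {M : Type*} [Monoid M] {n : ℕ} (g : Fin n → M) (h1 : ∀ i, g i * g i = g i)
    (h2 : ∀ i j, i < j → g i * g j * g i = g j * g i) (m : Fin n) (V : List (Fin n))
    (hV : ∀ s : List (Fin n), s.Pairwise (· > ·) → (∀ y ∈ s, y < m) → s.Sublist V →
        (m :: s).Sublist V) : g m * (V.map g).prod = (V.map g).prod := by
  have key := claimL (M := Mᵐᵒᵖ) (fun i => MulOpposite.op (g i.rev))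
    (fun i => by rw [← MulOpposite.op_mul, h1])
    (fun i j hij => by
      simp only [← MulOpposite.op_mul]
      rw [← mul_assoc, h2 _ _ (Fin.rev_lt_rev.2 hij)])
    m.rev (V.reverse.map Fin.rev) (by
      intro s hs hsm hsub
      have h3 := (hsub.map Fin.rev).reverse
      simp only [List.map_map, List.map_reverse, List.reverse_reverse] at h3
      have e : (Fin.rev ∘ Fin.rev : Fin n → Fin n) = id := by funext i; simp
      rw [e, List.map_id] at h3
      have h4 := hV ((s.map Fin.rev).reverse) (by
          rw [List.pairwise_reverse, List.pairwise_map]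
          exact hs.imp (fun h => Fin.rev_lt_rev.2 h)) (by
          intro y hy
          simp only [List.mem_reverse, List.mem_map] at hy
          obtain ⟨z, hz, rfl⟩ := hy
          have := hsm z hz
          rw [← Fin.rev_lt_rev]; simpa using this) h3
      have h5 := (h4.reverse.map Fin.rev)
      simpa [List.map_reverse, e] using h5)
  have e : ((V.reverse.map Fin.rev).map fun i => MulOpposite.op (g i.rev)).prod =
      MulOpposite.op (V.map g).prod := by
    rw [MulOpposite.op_list_prod]
    simp [List.map_reverse, Function.comp_def]
  rw [e] at key
  simp only [Fin.rev_rev, ← MulOpposite.op_mul] at key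
  exact MulOpposite.op_injective key
/-! ### The words -/

inductive Lt : Type
  | x : Lt
  | b : ℕ → Lt
  | c : ℕ → Lt
  deriving DecidableEq

def asc (K : ℕ) (f : ℕ → Lt) : List Lt := (List.range K).map f

def pre (r K : ℕ) (f : ℕ → Lt) : List Lt := (List.replicate r (Lt.x :: asc K f)).flatten

def uW (r K : ℕ) : List Lt := pre r K Lt.b ++ Lt.x :: (asc K Lt.b).reverse

def vW (K : ℕ) : List Lt := asc K Lt.c ++ Lt.x :: ((asc K Lt.c).reverse ++ [Lt.x])

def WW (r K j : ℕ) : List Lt := uW r K ++ (List.replicate j Lt.x ++ vW K)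

lemma sublist_pow {α : Type*} (l : List α) : ∀ (r : ℕ) (s : List α), s.length ≤ r →
    (∀ y ∈ s, y ∈ l) → s.Sublist (List.replicate r l).flatten := by
  intro r
  induction r with
  | zero => intro s hs _; simp_all
  | succ r ih =>
    intro s hs hl
    cases s with
    | nil => simp
    | cons y s =>
      rw [List.replicate_succ, List.flatten_cons]
      exact List.Sublist.append (l₁ := [y])
        (by simpa using hl y (by simp)) (ih s (by simpa using hs) (fun z hz => hl z (by simp [hz])))

lemma dec_length_gt {n : ℕ} (m : Fin n) (s : List (Fin n)) (hs : s.Pairwise (· > ·))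
    (h : ∀ y ∈ s, m < y) : s.length ≤ n - 1 - m.val := by
  have hnd : s.Nodup := hs.imp (fun h => ne_of_gt h)
  rw [← List.toFinset_card_of_nodup hnd, ← Fin.card_Ioi]
  apply Finset.card_le_card
  intro y hy
  simpa using h y (by simpa using hy)

lemma dec_length_lt {n : ℕ} (m : Fin n) (s : List (Fin n)) (hs : s.Pairwise (· > ·))
    (h : ∀ y ∈ s, y < m) : s.length ≤ m.val := by
  have hnd : s.Nodup := hs.imp (fun h => ne_of_gt h)
  rw [← List.toFinset_card_of_nodup hnd, ← Fin.card_Iio]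
  apply Finset.card_le_card
  intro y hy
  simpa using h y (by simpa using hy)

lemma stylGen_idem (n : ℕ) (i : Fin n) : stylGen n i * stylGen n i = stylGen n i :=
  PresentedMonoid.mk_eq_mk_of_rel (rels := stylRel n) (Or.inl ⟨i, rfl, rfl⟩)

lemma stylGen_rel1 (n : ℕ) (i j : Fin n) (h : i < j) :
    stylGen n i * stylGen n j * stylGen n i = stylGen n j * stylGen n i := by
  have : stylGen n j * stylGen n i * stylGen n i = stylGen n i * stylGen n j * stylGen n i :=
    PresentedMonoid.mk_eq_mk_of_rel (rels := stylRel n)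
      (Or.inr (Or.inr (Or.inr (Or.inl ⟨i, j, h, rfl, rfl⟩))))
  rw [← this, mul_assoc, stylGen_idem]

lemma stylGen_rel2 (n : ℕ) (i j : Fin n) (h : i < j) :
    stylGen n j * stylGen n i * stylGen n j = stylGen n j * stylGen n i := by
  have : stylGen n j * stylGen n j * stylGen n i = stylGen n j * stylGen n i * stylGen n j :=
    PresentedMonoid.mk_eq_mk_of_rel (rels := stylRel n)
      (Or.inr (Or.inr (Or.inr (Or.inr ⟨i, j, h, rfl, rfl⟩))))
  rw [← this, stylGen_idem]

lemma styl_exists_list (n : ℕ) (y : Styl n) : ∃ l : List (Fin n), (l.map (stylGen n)).prod = y := by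
  obtain ⟨w, rfl⟩ := PresentedMonoid.surjective_mk y
  refine ⟨w.toList, ?_⟩
  induction w using FreeMonoid.inductionOn' with
  | one => simp
  | of_mul a w ih =>
    rw [FreeMonoid.toList_of_mul, List.map_cons, List.prod_cons, ih, map_mul]; rfl

/-- The abstract insertion identity. -/
lemma insert_identity (n r : ℕ) (hn : n = r + 3) (X A B C D : List (Fin n))
    (hB : ∀ y ∈ B, y ∈ A) (hC : ∀ y ∈ C, y ∈ D) (ys zs : List (Fin n)) (hX : X = ys ++ zs) :
    ((((List.replicate r (X ++ A)).flatten ++ (X ++ B)) ++ ys).map (stylGen n)).prod *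
      ((C ++ (X ++ (D ++ X))).map (stylGen n)).prod =
    (((List.replicate r (X ++ A)).flatten ++ (X ++ B)).map (stylGen n)).prod *
      ((C ++ (X ++ (D ++ X))).map (stylGen n)).prod := by
  induction ys using List.reverseRecOn generalizing zs with
  | nil => simp
  | append_singleton ys z ih =>
    have hz : z ∈ X := by rw [hX]; simp
    rw [← ih (z :: zs) (by simpa using hX)]
    have hys : ∀ y ∈ ys, y ∈ X := by intro y hy; rw [hX]; simp [hy]
    generalize hU : ((List.replicate r (X ++ A)).flatten ++ (X ++ B)) = U0
    generalize hV : (C ++ (X ++ (D ++ X))) = V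
    have e : ((U0 ++ (ys ++ [z])).map (stylGen n)).prod =
      ((U0 ++ ys).map (stylGen n)).prod * stylGen n z := by simp [mul_assoc]
    rw [e]
    by_cases hz2 : 2 ≤ z.val
    · rw [claimL (stylGen n) (stylGen_idem n) (stylGen_rel2 n)]
      intro s hs hsz hsub
      have hlen := dec_length_gt z s hs hsz
      have hmem : ∀ y ∈ s, y ∈ X ++ A := by
        intro y hy
        have := hsub.subset hy
        rw [← hU] at this
        simp only [List.mem_append, List.mem_flatten, List.mem_replicate] at this ⊢
        rcases this with (⟨l, ⟨_, rfl⟩, h⟩ | h | h) | h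
        · simpa using h
        · exact Or.inl h
        · exact Or.inr (hB y h)
        · exact Or.inl (hys y h)
      have h1 := sublist_pow (X ++ A) r s (by omega) hmem
      have h2 : [z].Sublist X := by simpa using hz
      rw [← hU]
      have h3 := h1.append h2
      refine h3.trans ?_
      simp only [List.append_assoc, List.append_sublist_append_left]
      exact List.sublist_append_left _ _
    · rw [mul_assoc, claimR (stylGen n) (stylGen_idem n) (stylGen_rel1 n)]
      intro s hs hsz hsub
      have hlen := dec_length_lt z s hs hsz
      have hmem : ∀ y ∈ s, y ∈ D ++ X := by
        intro y hy
        have := hsub.subset hy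
        rw [← hV] at this
        simp only [List.mem_append] at this ⊢
        rcases this with h | h | h | h
        · exact Or.inl (hC y h)
        · exact Or.inr h
        · exact Or.inl h
        · exact Or.inr h
      have h1 := sublist_pow (D ++ X) 1 s (by omega) hmem
      have h2 : [z].Sublist X := by simpa using hz
      rw [← hV]
      have h3 := h2.append h1
      refine List.Sublist.trans ?_ (List.sublist_append_right _ _)
      simpa using h3

lemma styl_identity (n r K : ℕ) (hn : n = r + 3) (φ : FreeMonoid Lt →* Styl n) :
    φ (FreeMonoid.ofList (WW r K 1)) = φ (FreeMonoid.ofList (WW r K 0)) := by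
  choose Φ hΦ using fun y : Lt => styl_exists_list n (φ (FreeMonoid.of y))
  have key : ∀ l : List Lt, φ (FreeMonoid.ofList l) = ((l.flatMap Φ).map (stylGen n)).prod := by
    intro l
    induction l with
    | nil => simp
    | cons y l ih =>
      rw [FreeMonoid.ofList_cons, map_mul, ih, ← hΦ, List.flatMap_cons, List.map_append,
        List.prod_append]
  rw [key, key]
  have := insert_identity n r hn (Φ Lt.x) ((asc K Lt.b).flatMap Φ) ((asc K Lt.b).reverse.flatMap Φ)
    ((asc K Lt.c).flatMap Φ) ((asc K Lt.c).reverse.flatMap Φ)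
    (by intro y hy; simpa using hy) (by intro y hy; simpa using hy) (Φ Lt.x) [] (by simp)
  rw [← List.prod_append, ← List.map_append, ← List.prod_append, ← List.map_append] at this
  have e : ∀ r, (pre r K Lt.b).flatMap Φ =
      (List.replicate r (Φ Lt.x ++ (asc K Lt.b).flatMap Φ)).flatten := by
    intro r
    induction r with
    | zero => simp [pre]
    | succ r ih =>
      unfold pre at ih ⊢
      simp [List.replicate_succ, ih]
  simpa [WW, uW, vW, e] using this

/-! ### Combinatorics of subwords -/

lemma SubLe.append {α : Type*} {n : ℕ} {l l' m m' : List α} (h : SubLe n l l') (h' : SubLe n m m') :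
    SubLe n (l ++ m) (l' ++ m') := by
  intro s hs hsub
  obtain ⟨s1, s2, rfl, h1, h2⟩ := List.sublist_append_iff.1 hsub
  rw [List.length_append] at hs
  exact (h s1 (by omega) h1).append (h' s2 (by omega) h2)

lemma exists_sub_flatMap {α β : Type*} (θ : α → List β) (p : List α) : ∀ s : List β,
    s.Sublist (p.flatMap θ) → ∃ s' : List α, s'.Sublist p ∧ s'.length ≤ s.length ∧
      s.Sublist (s'.flatMap θ) := by
  induction p with
  | nil => intro s hs; exact ⟨[], by simp, by simp, by simpa using hs⟩
  | cons t p ih =>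
    intro s hs
    rw [List.flatMap_cons] at hs
    obtain ⟨s1, s2, rfl, h1, h2⟩ := List.sublist_append_iff.1 hs
    obtain ⟨s', ha, hb, hc⟩ := ih s2 h2
    cases s1 with
    | nil => exact ⟨s', ha.cons _, by simpa using hb, by simpa using hc⟩
    | cons y s1 =>
      refine ⟨t :: s', ha.cons_cons _, by simp; omega, ?_⟩
      rw [List.flatMap_cons]
      exact h1.append hc

lemma sublist_flatMap_of {α β : Type*} {p q : List α} (h : p.Sublist q) (θ : α → List β) :
    (p.flatMap θ).Sublist (q.flatMap θ) := by
  induction h with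
  | slnil => simp
  | cons a _ ih => rw [List.flatMap_cons]; exact ih.trans (List.sublist_append_right _ _)
  | cons_cons a _ ih => rw [List.flatMap_cons, List.flatMap_cons]; exact (List.Sublist.refl _).append ih

lemma SubLe.flatMap {α β : Type*} {n : ℕ} {p q : List α} (h : SubLe n p q) (θ : α → List β) :
    SubLe n (p.flatMap θ) (q.flatMap θ) := by
  intro s hs hsub
  obtain ⟨s', ha, hb, hc⟩ := exists_sub_flatMap θ p s hsub
  exact hc.trans (sublist_flatMap_of (h s' (by omega) ha) θ)

lemma SubLe.mem {α : Type*} {n : ℕ} {p q : List α} (h : SubLe n p q) (hn : 1 ≤ n) {t : α}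
    (ht : t ∈ p) : t ∈ q := by
  have := h [t] (by simpa using hn) (by simpa using ht)
  simpa using this

lemma cover2 {α β : Type*} (θ : α → List β) (p : List α) (y y2 : β) (m : List β)
    (h : p.flatMap θ = y :: y2 :: m) :
    (∃ p1 t p2, p = p1 ++ t :: p2 ∧ θ t = [y] ∧ p1.flatMap θ = [] ∧ p2.flatMap θ = y2 :: m) ∨
    ∃ t ∈ p, [y, y2] <:+: θ t := by
  induction p with
  | nil => simp at h
  | cons t p ih =>
    rw [List.flatMap_cons] at h
    rcases ht : θ t with _ | ⟨z, _ | ⟨z2, l⟩⟩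
    · rw [ht] at h
      rcases ih (by simpa using h) with ⟨p1, t', p2, rfl, h1, h2, h3⟩ | ⟨t', h1, h2⟩
      · exact Or.inl ⟨t :: p1, t', p2, by simp, h1, by simp [ht, h2], h3⟩
      · exact Or.inr ⟨t', by simp [h1], h2⟩
    · rw [ht] at h
      simp only [List.cons_append, List.nil_append, List.cons.injEq] at h
      exact Or.inl ⟨[], t, p, by simp, by rw [ht, h.1], by simp, h.2⟩
    · rw [ht] at h
      simp only [List.cons_append, List.cons.injEq] at h
      refine Or.inr ⟨t, by simp, ?_⟩
      rw [ht, h.1, h.2.1]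
      exact ⟨[], l, by simp⟩

lemma cover3 {α β : Type*} (θ : α → List β) (p : List α) (l : List β) (y1 y y2 : β) (m : List β)
    (h : p.flatMap θ = l ++ y1 :: y :: y2 :: m) :
    (∃ p1 t p2, p = p1 ++ t :: p2 ∧ θ t = [y] ∧ p1.flatMap θ = l ++ [y1] ∧
      p2.flatMap θ = y2 :: m) ∨
    ∃ t ∈ p, [y1, y] <:+: θ t ∨ [y, y2] <:+: θ t := by
  induction p generalizing l with
  | nil => simp at h
  | cons t p ih =>
    rw [List.flatMap_cons] at h
    rcases List.append_eq_append_iff.1 h with ⟨l', hl, h'⟩ | ⟨l', hl, h'⟩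
    · rcases ih l' h' with ⟨p1, t', p2, rfl, h1, h2, h3⟩ | ⟨t', h1, h2⟩
      · exact Or.inl ⟨t :: p1, t', p2, by simp, h1, by simp [hl, h2], h3⟩
      · exact Or.inr ⟨t', by simp [h1], h2⟩
    · rcases l' with _ | ⟨z, _ | ⟨z2, l'⟩⟩
      · rcases ih [] (by simpa using h'.symm) with ⟨p1, t', p2, rfl, h1, h2, h3⟩ | ⟨t', h1, h2⟩
        · exact Or.inl ⟨t :: p1, t', p2, by simp, h1, by simp [hl, h2], h3⟩
        · exact Or.inr ⟨t', by simp [h1], h2⟩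
      · simp only [List.cons_append, List.nil_append, List.cons.injEq] at h'
        rcases cover2 θ p y y2 m h'.2.symm with ⟨p1, t', p2, rfl, h1, h2, h3⟩ | ⟨t', h1, h2⟩
        · exact Or.inl ⟨t :: p1, t', p2, by simp, h1, by simp [hl, h2, h'.1], h3⟩
        · exact Or.inr ⟨t', by simp [h1], Or.inr h2⟩
      · simp only [List.cons_append, List.cons.injEq] at h'
        refine Or.inr ⟨t, by simp, Or.inl ?_⟩
        rw [hl, h'.1, h'.2.1]
        exact ⟨l, l', by simp⟩
lemma mem_asc {K : ℕ} {f : ℕ → Lt} {y : Lt} : y ∈ asc K f ↔ ∃ i < K, f i = y := by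
  simp [asc]

lemma mem_pre {r K : ℕ} {f : ℕ → Lt} {y : Lt} (h : y ∈ pre r K f) : y = Lt.x ∨ y ∈ asc K f := by
  simp only [pre, List.mem_flatten, List.mem_replicate] at h
  obtain ⟨l, ⟨_, rfl⟩, h⟩ := h
  simpa using h

lemma asc_chain (K : ℕ) (f : ℕ → Lt) (hf : f.Injective) (i : ℕ) :
    (asc K f).IsChain (fun y y' => ¬ (y = f (i + 1) ∧ y' = f i)) := by
  unfold asc
  rw [List.isChain_map]
  apply List.Pairwise.isChain
  refine List.pairwise_lt_range.imp ?_
  rintro a b hab ⟨h1, h2⟩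
  have := hf h1; have := hf h2
  omega

lemma pre_chain (K r : ℕ) (f : ℕ → Lt) (hf : f.Injective) (hx : ∀ i, f i ≠ Lt.x) (i : ℕ) :
    (pre r K f ++ [Lt.x]).IsChain (fun y y' => ¬ (y = f (i + 1) ∧ y' = f i)) := by
  induction r with
  | zero => simp [pre]
  | succ r ih =>
    have e : pre (r + 1) K f ++ [Lt.x] = [Lt.x] ++ (asc K f ++ (pre r K f ++ [Lt.x])) := by
      simp [pre, List.replicate_succ]
    have hh : ∀ y ∈ (pre r K f ++ [Lt.x]).head?, y = Lt.x := by
      cases r <;> simp [pre, List.replicate_succ]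
    rw [e, List.isChain_append, List.isChain_append]
    refine ⟨by simp, ⟨asc_chain K f hf i, ih, ?_⟩, ?_⟩
    · rintro y _ y' hy' ⟨_, h⟩
      exact hx i (h.symm.trans (hh y' hy'))
    · rintro y hy y' _ ⟨h, _⟩
      simp only [List.getLast?_singleton, Option.mem_def, Option.some.injEq] at hy
      exact hx _ (h.symm.trans hy.symm)

/-- Location of the letter `x` after a descent of the `f`-letters. -/
lemma locate (K r : ℕ) (f : ℕ → Lt) (hf : f.Injective) (hx : ∀ i, f i ≠ Lt.x) (i : ℕ)
    (v l l' m : List Lt)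
    (h : pre r K f ++ Lt.x :: (asc K f).reverse ++ v = l ++ [f (i + 1), f i] ++ l' ++ Lt.x :: m) :
    (pre r K f ++ Lt.x :: (asc K f).reverse).length ≤ (l ++ [f (i + 1), f i] ++ l').length := by
  have h1 : (pre r K f ++ [Lt.x]).length ≤ l.length + 1 := by
    by_contra hc
    have p1 : (l ++ [f (i + 1), f i]) <+: (pre r K f ++ Lt.x :: (asc K f).reverse ++ v) := by
      rw [h]; exact ⟨l' ++ Lt.x :: m, by simp⟩
    have p2 : (pre r K f ++ [Lt.x]) <+: (pre r K f ++ Lt.x :: (asc K f).reverse ++ v) :=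
      ⟨(asc K f).reverse ++ v, by simp⟩
    have p3 := List.prefix_of_prefix_length_le p1 p2 (by simp at hc ⊢; omega)
    have p4 := (pre_chain K r f hf hx i).infix p3.isInfix
    rw [List.isChain_append] at p4
    simp at p4
  by_contra hc
  have h2 : (pre r K f ++ [Lt.x] ++ (asc K f).reverse ++ v)[(l ++ [f (i + 1), f i] ++ l').length]? =
      some Lt.x := by
    have e : pre r K f ++ [Lt.x] ++ (asc K f).reverse ++ v =
      pre r K f ++ Lt.x :: (asc K f).reverse ++ v := by simp
    rw [e, h, List.getElem?_append_right le_rfl]; simp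
  simp only [List.length_append, List.length_cons, List.length_nil, List.length_reverse] at h1 hc h2
  rw [List.getElem?_append_left (by simp; omega),
    List.getElem?_append_right (by simp; omega)] at h2
  have h3 := List.mem_of_getElem? h2
  rw [List.mem_reverse, mem_asc] at h3
  obtain ⟨j, _, hj⟩ := h3
  exact hx j hj

lemma asc_reverse_triple (K : ℕ) (f : ℕ → Lt) (i : ℕ) (hi : i + 2 < K) :
    ∃ l m, (asc K f).reverse = l ++ f (i + 2) :: f (i + 1) :: f i :: m := by
  have : asc K f = asc i f ++ (f i :: f (i + 1) :: f (i + 2) ::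
      (List.range (K - i - 3)).map (fun j => f (i + 3 + j))) := by
    obtain ⟨d, rfl⟩ : ∃ d, K = i + (3 + d) := ⟨K - i - 3, by omega⟩
    have e : i + (3 + d) - i - 3 = d := by omega
    rw [e]
    unfold asc
    rw [List.range_add, List.range_add]
    simp [List.range_succ, Function.comp_def, add_assoc]
  rw [this]
  exact ⟨((List.range (K - i - 3)).map (fun j => f (i + 3 + j))).reverse, (asc i f).reverse,
    by simp⟩

lemma left_witness {α : Type*} (K r : ℕ) (f : ℕ → Lt) (hf : f.Injective) (hx : ∀ i, f i ≠ Lt.x)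
    (v : List Lt) (θ : α → List Lt) (p q1 q2 : List α) (X : α) (hX : θ X = [Lt.x])
    (hp : p.flatMap θ = pre r K f ++ Lt.x :: (asc K f).reverse ++ v)
    (hpq : ∀ t ∈ p, t ∈ q1 ++ X :: q2) (hq2 : ∀ i, f i ∉ q2.flatMap θ) (hK : p.length + 2 < K) :
    ∃ L ∈ q1, ∀ p1 p2, p = p1 ++ X :: p2 → L ∈ p1 →
      (pre r K f ++ Lt.x :: (asc K f).reverse).length ≤ (p1.flatMap θ).length := by
  classical
  have hL : ∃ L ∈ p, ∃ i, [f (i + 1), f i] <:+: θ L := by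
    by_contra hc
    push Not at hc
    have h1 : ∀ i : Fin (K - 2), ∃ t ∈ p, θ t = [f (i + 1)] := by
      intro i
      obtain ⟨l, m, hlm⟩ := asc_reverse_triple K f i.val (by omega)
      rw [hlm] at hp
      rcases cover3 θ p (pre r K f ++ Lt.x :: l) (f (i + 2)) (f (i + 1)) (f i) (m ++ v)
        (by rw [hp]; simp) with ⟨p1, t, p2, rfl, ht, _⟩ | ⟨t, ht, h | h⟩
      · exact ⟨t, by simp, ht⟩
      · exact absurd h (hc t ht _)
      · exact absurd h (hc t ht _)
    choose T hT1 hT2 using h1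
    have hinj : Function.Injective T := by
      intro i j hij
      have := hT2 i
      rw [hij, hT2 j] at this
      have := hf (List.cons.inj this).1
      ext; omega
    have h2 : (Finset.univ.image T) ⊆ p.toFinset := by
      intro t ht
      simp only [Finset.mem_image, Finset.mem_univ, true_and] at ht
      obtain ⟨i, rfl⟩ := ht
      simpa using hT1 i
    have h3 := Finset.card_le_card h2
    rw [Finset.card_image_of_injective _ hinj, Finset.card_univ, Fintype.card_fin] at h3
    have h4 := List.toFinset_card_le p
    omega
  obtain ⟨L, hLp, i, hLi⟩ := hL
  have hfi : f i ∈ θ L := hLi.subset (by simp)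
  refine ⟨L, ?_, ?_⟩
  · have := hpq L hLp
    rw [List.mem_append, List.mem_cons] at this
    rcases this with h | rfl | h
    · exact h
    · rw [hX] at hfi
      exact absurd (by simpa using hfi) (hx i)
    · exact absurd (List.mem_flatMap.2 ⟨L, h, hfi⟩) (hq2 i)
  · intro p1 p2 hpp hLp1
    obtain ⟨p3, p4, rfl⟩ := List.append_of_mem hLp1
    obtain ⟨l, l', hl⟩ := hLi
    have e : (p3 ++ L :: p4).flatMap θ = (p3.flatMap θ ++ l) ++ [f (i + 1), f i] ++
        (l' ++ p4.flatMap θ) := by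
      rw [List.flatMap_append, List.flatMap_cons, ← hl]; simp
    rw [e]
    apply locate K r f hf hx i v _ _ (p2.flatMap θ)
    rw [← hp, hpp, List.flatMap_append, e, List.flatMap_cons, hX]
    simp

lemma uW_last (r K : ℕ) (hK : 1 ≤ K) : ∃ l, uW r K = l ++ [Lt.b 0] := by
  obtain ⟨d, rfl⟩ : ∃ d, K = d + 1 := ⟨K - 1, by omega⟩
  refine ⟨pre r (d + 1) Lt.b ++ Lt.x :: ((List.range d).map (fun i => Lt.b (i + 1))).reverse, ?_⟩
  simp [uW, asc, List.range_succ_eq_map, Function.comp_def]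

lemma vW_first (K : ℕ) (hK : 1 ≤ K) : ∃ l, vW K = Lt.c 0 :: l := by
  obtain ⟨d, rfl⟩ : ∃ d, K = d + 1 := ⟨K - 1, by omega⟩
  simp [vW, asc, List.range_succ_eq_map]

def okAdj (y y' : Lt) : Prop := ¬ (y = Lt.b 0 ∧ y' = Lt.x) ∧ ¬ (y = Lt.x ∧ (y' = Lt.x ∨ y' = Lt.c 0))

lemma okAdj_asc (K : ℕ) (f : ℕ → Lt) (hx : ∀ i, f i ≠ Lt.x) : (asc K f).IsChain okAdj := by
  apply List.Pairwise.isChain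
  unfold asc
  rw [List.pairwise_map]
  refine List.pairwise_lt_range.imp ?_
  intro i j _
  simp [okAdj, hx]

lemma okAdj_asc_rev (K : ℕ) (f : ℕ → Lt) (hx : ∀ i, f i ≠ Lt.x) :
    (asc K f).reverse.IsChain okAdj := by
  apply List.Pairwise.isChain
  unfold asc
  rw [List.pairwise_reverse, List.pairwise_map]
  refine List.pairwise_lt_range.imp ?_
  intro i j _
  simp [okAdj, hx]

lemma WW_chain (r K : ℕ) (hK : 2 ≤ K) : (WW r K 0).IsChain okAdj := by
  have hb : ∀ i, Lt.b i ≠ Lt.x := by intro i h; cases h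
  have hc : ∀ i, Lt.c i ≠ Lt.x := by intro i h; cases h
  have hK0 : K ≠ 0 := by omega
  have hK1 : K - 1 ≠ 0 := by omega
  have hlast : ∀ f : ℕ → Lt, (asc K f).getLast? = some (f (K - 1)) := by
    intro f; simp [asc, List.getLast?_range, hK0]
  have hhead : ∀ f : ℕ → Lt, (asc K f).head? = some (f 0) := by
    intro f; simp [asc, List.head?_range, hK0]
  have hv : (vW K).IsChain okAdj := by
    have e : vW K = asc K Lt.c ++ ([Lt.x] ++ ((asc K Lt.c).reverse ++ [Lt.x])) := by simp [vW]
    rw [e, List.isChain_append, List.isChain_append, List.isChain_append]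
    refine ⟨okAdj_asc K _ hc, ⟨by simp, ⟨okAdj_asc_rev K _ hc, by simp, ?_⟩, ?_⟩, ?_⟩
    · simp [hhead, okAdj]
    · simp [hlast, okAdj]; omega
    · simp [hlast, okAdj]
  have hBv : (Lt.x :: (asc K Lt.b).reverse ++ vW K).IsChain okAdj := by
    have e : Lt.x :: (asc K Lt.b).reverse ++ vW K = [Lt.x] ++ ((asc K Lt.b).reverse ++ vW K) := by
      simp
    obtain ⟨l, hl⟩ := vW_first K (by omega)
    rw [e, List.isChain_append, List.isChain_append]
    refine ⟨by simp, ⟨okAdj_asc_rev K _ hb, hv, ?_⟩, ?_⟩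
    · simp [hhead, okAdj, hl]
    · simp [hlast, okAdj]
  have main : ∀ r, (pre r K Lt.b ++ (Lt.x :: (asc K Lt.b).reverse ++ vW K)).IsChain okAdj := by
    intro r
    induction r with
    | zero => simpa [pre] using hBv
    | succ r ih =>
      have e : pre (r + 1) K Lt.b ++ (Lt.x :: (asc K Lt.b).reverse ++ vW K) =
          [Lt.x] ++ (asc K Lt.b ++ (pre r K Lt.b ++ (Lt.x :: (asc K Lt.b).reverse ++ vW K))) := by
        simp [pre, List.replicate_succ]
      have hh : (pre r K Lt.b ++ (Lt.x :: (asc K Lt.b).reverse ++ vW K)).head? = some Lt.x := by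
        cases r <;> simp [pre, List.replicate_succ]
      rw [e, List.isChain_append, List.isChain_append]
      refine ⟨by simp, ⟨okAdj_asc K _ hb, ih, ?_⟩, ?_⟩
      · rw [hh, hlast]; simp [okAdj]; omega
      · simp [hhead, okAdj]
  have := main r
  simpa [WW, uW] using this

lemma WW_no_infix (r K : ℕ) (hK : 2 ≤ K) (y y' : Lt) (h : [y, y'] <:+: WW r K 0) : okAdj y y' := by
  have := (WW_chain r K hK).infix h
  simpa using this

lemma not_insert {α : Type*} (n r K j : ℕ) (hn : 3 ≤ n) (θ : α → List Lt) (p q : List α)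
    (hK : p.length + 2 < K)
    (hpq : SubLe n p q) (hqp : SubLe n q p) (hp : p.flatMap θ = WW r K 0)
    (hq : q.flatMap θ = WW r K j) : j = 0 := by
  by_contra hj
  obtain ⟨j, rfl⟩ : ∃ i, j = i + 1 := ⟨j - 1, by omega⟩
  obtain ⟨lu, hlu⟩ := uW_last r K (by omega)
  obtain ⟨lv, hlv⟩ := vW_first K (by omega)
  obtain ⟨y2, m, hm, hy2⟩ : ∃ y2 m, List.replicate j Lt.x ++ vW K = y2 :: m ∧
      (y2 = Lt.x ∨ y2 = Lt.c 0) := by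
    cases j with
    | zero => exact ⟨Lt.c 0, lv, by simp [hlv], Or.inr rfl⟩
    | succ j => exact ⟨Lt.x, List.replicate j Lt.x ++ vW K, by simp [List.replicate_succ], Or.inl rfl⟩
  have hinf : ∀ t ∈ q, θ t <:+: WW r K 0 := by
    intro t ht
    have := hqp.mem (by omega) ht
    obtain ⟨p3, p4, rfl⟩ := List.append_of_mem this
    rw [← hp]
    exact ⟨p3.flatMap θ, p4.flatMap θ, by simp⟩
  have hq' : q.flatMap θ = lu ++ Lt.b 0 :: Lt.x :: y2 :: m := by
    rw [hq, WW, hlu, ← hm]; simp [List.replicate_succ]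
  rcases cover3 θ q _ _ _ _ _ hq' with ⟨q1, X, q2, rfl, hX, hq1, hq2⟩ | ⟨t, ht, h | h⟩
  · rw [← hlu] at hq1
    rw [← hm] at hq2
    have hp1 : p.flatMap θ = pre r K Lt.b ++ Lt.x :: (asc K Lt.b).reverse ++ vW K := by
      rw [hp]; simp [WW, uW]
    obtain ⟨L, hL, hL'⟩ := left_witness K r Lt.b (by intro i j h; simpa using h) (by simp) (vW K)
      θ p q1 q2 X hX hp1 (fun t ht => hpq.mem (by omega) ht)
      (by intro i; rw [hq2]; simp [vW, mem_asc]) hK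
    have hp2 : p.reverse.flatMap (fun t => (θ t).reverse) =
        pre 1 K Lt.c ++ Lt.x :: (asc K Lt.c).reverse ++ (uW r K).reverse := by
      have : p.reverse.flatMap (fun t => (θ t).reverse) = (p.flatMap θ).reverse := by
        rw [List.reverse_flatMap]; rfl
      rw [this, hp]; simp [WW, vW, pre]
    obtain ⟨R, hR, hR'⟩ := left_witness K 1 Lt.c (by intro i j h; simpa using h) (by simp)
      (uW r K).reverse (fun t => (θ t).reverse) p.reverse q2.reverse q1.reverse X (by simp [hX]) hp2
      (fun t ht => by
        have := hpq.mem (by omega) (List.mem_reverse.1 ht)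
        simp only [List.mem_append, List.mem_cons, List.mem_reverse] at this ⊢
        tauto)
      (by
        intro i
        have : q1.reverse.flatMap (fun t => (θ t).reverse) = (q1.flatMap θ).reverse := by
          rw [List.reverse_flatMap]; rfl
        rw [this, hq1, List.mem_reverse, uW]
        intro h
        rw [List.mem_append] at h
        rcases h with h | h
        · have := mem_pre h
          simp [mem_asc] at this
        · simp [mem_asc] at h)
      (by simpa using hK)
    have hs : ([L] ++ ([X] ++ [R])).Sublist p := by
      apply hqp _ (by simpa using hn)
      refine List.Sublist.append (by simpa using hL) ?_
      have : R ∈ q2 := by simpa using hR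
      exact (List.cons_sublist_cons).2 (by simpa using this)
    obtain ⟨r1, r2, hr, h1, h2⟩ := List.append_sublist_iff.1 hs
    obtain ⟨r3, r4, hr', h3, h4⟩ := List.append_sublist_iff.1 h2
    have hX3 : X ∈ r3 := by simpa using h3
    obtain ⟨r5, r6, hr6⟩ := List.append_of_mem hX3
    have hpe : p = (r1 ++ r5) ++ X :: (r6 ++ r4) := by rw [hr, hr', hr6]; simp
    have b1 := hL' _ _ hpe (by
      have : L ∈ r1 := by simpa using h1
      simp [this])
    have b2 := hR' (r6 ++ r4).reverse (r1 ++ r5).reverse (by rw [hpe]; simp) (by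
      have : R ∈ r4 := by simpa using h4
      simp [this])
    have b3 : ((r6 ++ r4).reverse.flatMap (fun t => (θ t).reverse)).length =
        ((r6 ++ r4).flatMap θ).length := by
      rw [← List.length_reverse (as := (r6 ++ r4).flatMap θ), List.reverse_flatMap]; rfl
    rw [b3] at b2
    have b4 := congrArg List.length hp
    rw [hpe, List.flatMap_append, List.flatMap_cons, hX] at b4
    simp only [WW, uW, vW, pre, List.length_append, List.length_cons, List.length_nil,
      List.length_reverse, List.replicate_one, List.replicate_zero, List.flatten_cons,
      List.flatten_nil] at b1 b2 b4
    omega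
  · have := WW_no_infix r K (by omega) _ _ (h.trans (hinf t ht))
    simp [okAdj] at this
  · have := WW_no_infix r K (by omega) _ _ (h.trans (hinf t ht))
    rcases hy2 with rfl | rfl <;> simp [okAdj] at this
/-! ### Rigidity -/

lemma two_letter {α : Type*} [DecidableEq α] (y z : α) (hyz : y ≠ z) : ∀ (l1 l2 : List α),
    (∀ t ∈ l1, t = y ∨ t = z) → (∀ t ∈ l2, t = y ∨ t = z) →
    l1.count y = l2.count y → l1.count z = l2.count z →
    (∀ a b : ℕ, 1 ≤ a → 1 ≤ b → ((List.replicate a y ++ List.replicate b z).Sublist l1 ↔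
      (List.replicate a y ++ List.replicate b z).Sublist l2)) → l1 = l2 := by
  have aux : ∀ (l1 l2 : List α), (y :: l1).count z = (z :: l2).count z →
      (∀ a b : ℕ, 1 ≤ a → 1 ≤ b → ((List.replicate a y ++ List.replicate b z).Sublist (y :: l1) ↔
      (List.replicate a y ++ List.replicate b z).Sublist (z :: l2))) → False := by
    intro l1 l2 hc H
    have h := H 1 (l2.count z + 1) le_rfl (by omega)
    have h1 : (List.replicate 1 y ++ List.replicate (l2.count z + 1) z).Sublist (y :: l1) := by
      simp only [List.replicate_one, List.singleton_append, List.cons_sublist_cons,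
        List.replicate_sublist_iff]
      simp [hyz] at hc
      omega
    have h2 := h.1 h1
    simp only [List.replicate_one, List.singleton_append] at h2
    cases h2 with
    | cons _ h3 =>
      have := ((List.sublist_cons_self _ _).trans h3).count_le z
      simp at this
    | cons_cons _ h3 => exact hyz rfl
  intro l1
  induction l1 with
  | nil =>
    intro l2 _ h2 hy hz _
    cases l2 with
    | nil => rfl
    | cons t l2 =>
      rcases h2 t (by simp) with rfl | rfl
      · simp at hy
      · simp at hz
  | cons t l1 ih =>
    intro l2 h1 h2 hy hz H
    cases l2 with
    | nil =>
      rcases h1 t (by simp) with rfl | rfl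
      · simp at hy
      · simp at hz
    | cons t' l2 =>
      have h1' : ∀ t ∈ l1, t = y ∨ t = z := fun s hs => h1 s (by simp [hs])
      have h2' : ∀ t ∈ l2, t = y ∨ t = z := fun s hs => h2 s (by simp [hs])
      rcases h1 t (by simp) with rfl | rfl <;> rcases h2 t' (by simp) with rfl | rfl
      · congr 1
        refine ih l2 h1' h2' (by simpa using hy) (by simpa [hyz] using hz) ?_
        intro a b ha hb
        have := H (a + 1) b (by omega) hb
        simpa [List.replicate_succ] using this
      · exact (aux l1 l2 hz H).elim
      · exact (aux l2 l1 hz.symm (fun a b ha hb => (H a b ha hb).symm)).elim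
      · congr 1
        refine ih l2 h1' h2' (by simpa [hyz.symm] using hy) (by simpa using hz) ?_
        intro a b ha hb
        have := H a b ha hb
        obtain ⟨a, rfl⟩ : ∃ i, a = i + 1 := ⟨a - 1, by omega⟩
        have e : ∀ l : List α, (List.replicate (a + 1) y ++ List.replicate b t').Sublist (t' :: l) ↔
            (List.replicate (a + 1) y ++ List.replicate b t').Sublist l := by
          intro l
          rw [List.replicate_succ, List.cons_append]
          constructor
          · intro h
            cases h with
            | cons _ h => exact h
            | cons_cons _ h => exact absurd rfl hyz
          · intro h; exact h.cons _
        rwa [e, e] at this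

lemma pair_det {α : Type*} [DecidableEq α] : ∀ (l1 l2 : List α),
    (∀ y, l1.count y = l2.count y) →
    (∀ y z, y ≠ z → l1.filter (fun t => t = y ∨ t = z) = l2.filter (fun t => t = y ∨ t = z)) →
    l1 = l2 := by
  intro l1
  induction l1 with
  | nil =>
    intro l2 h _
    cases l2 with
    | nil => rfl
    | cons t l2 => have := h t; simp at this
  | cons t l1 ih =>
    intro l2 h H
    cases l2 with
    | nil => have := h t; simp at this
    | cons t' l2 =>
      by_cases htt : t = t'
      · subst htt
        congr 1
        apply ih
        · intro y
          have := h y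
          simpa [List.count_cons] using this
        · intro y z hyz
          have := H y z hyz
          rw [List.filter_cons, List.filter_cons] at this
          split_ifs at this
          · exact (List.cons.inj this).2
          · exact this
      · have := H t t' htt
        simp [htt] at this

lemma filter_rep {α : Type*} [DecidableEq α] (y z : α) (a b : ℕ) (l : List α) :
    (List.replicate a y ++ List.replicate b z).Sublist (l.filter (fun t => t = y ∨ t = z)) ↔
    (List.replicate a y ++ List.replicate b z).Sublist l := by
  constructor
  · intro h; exact h.trans List.filter_sublist
  · intro h
    have := h.filter (fun t => decide (t = y ∨ t = z))
    rwa [List.filter_eq_self.2] at this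
    intro t ht
    simp only [List.mem_append, List.mem_replicate] at ht
    simp; tauto

/-- Two words are equal if they have the same counts and the same two-block subwords, in one
orientation for each pair of letters. -/
lemma orient_det {α : Type*} [DecidableEq α] (l1 l2 : List α)
    (hc : ∀ y, l1.count y = l2.count y)
    (H : ∀ y z, y ≠ z →
      (∀ a b : ℕ, 1 ≤ a → 1 ≤ b → ((List.replicate a y ++ List.replicate b z).Sublist l1 ↔
        (List.replicate a y ++ List.replicate b z).Sublist l2)) ∨
      (∀ a b : ℕ, 1 ≤ a → 1 ≤ b → ((List.replicate a z ++ List.replicate b y).Sublist l1 ↔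
        (List.replicate a z ++ List.replicate b y).Sublist l2))) : l1 = l2 := by
  apply pair_det l1 l2 hc
  have main : ∀ y z, y ≠ z →
      (∀ a b : ℕ, 1 ≤ a → 1 ≤ b → ((List.replicate a y ++ List.replicate b z).Sublist l1 ↔
        (List.replicate a y ++ List.replicate b z).Sublist l2)) →
      l1.filter (fun t => t = y ∨ t = z) = l2.filter (fun t => t = y ∨ t = z) := by
    intro y z hyz h
    apply two_letter y z hyz
    · intro t ht; simpa using (List.mem_filter.1 ht).2
    · intro t ht; simpa using (List.mem_filter.1 ht).2
    · rw [List.count_filter (by simp), List.count_filter (by simp), hc]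
    · rw [List.count_filter (by simp), List.count_filter (by simp), hc]
    · intro a b ha hb
      rw [filter_rep, filter_rep]; exact h a b ha hb
  intro y z hyz
  rcases H y z hyz with h | h
  · exact main y z hyz h
  · have := main z y hyz.symm h
    simpa only [or_comm] using this

lemma count_flatten_le {α : Type*} [DecidableEq α] (y : α) (bl : List (List α))
    (h : ∀ l ∈ bl, l.count y ≤ 1) : bl.flatten.count y ≤ bl.length := by
  induction bl with
  | nil => simp
  | cons l bl ih =>
    have h1 := h l (by simp)
    have h2 := ih (fun l' hl' => h l' (by simp [hl']))
    simp only [List.flatten_cons, List.count_append, List.length_cons]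
    omega

lemma block_bound {α : Type*} [DecidableEq α] (y z : α) (bl : List (List α))
    (hy : ∀ l ∈ bl, l.count y ≤ 1) (hz : ∀ l ∈ bl, l.count z ≤ 1) : ∀ l1 l2 : List α,
    l1 ++ l2 = bl.flatten → l1.count y + l2.count z ≤ bl.length + 1 := by
  induction bl with
  | nil => intro l1 l2 h; simp_all
  | cons l bl ih =>
    intro l1 l2 h
    have hy1 := hy l (by simp)
    have hz1 := hz l (by simp)
    have ih := ih (fun l' hl' => hy l' (by simp [hl'])) (fun l' hl' => hz l' (by simp [hl']))
    have hc := count_flatten_le z bl (fun l' hl' => hz l' (by simp [hl']))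
    rw [List.flatten_cons] at h
    rcases List.append_eq_append_iff.1 h with ⟨m, rfl, rfl⟩ | ⟨m, rfl, hm⟩
    · simp only [List.count_append, List.length_cons] at *
      omega
    · have := ih m l2 hm.symm
      simp only [List.count_append, List.length_cons] at *
      omega

lemma block_bound' {α : Type*} [DecidableEq α] (y z : α) (bl : List (List α))
    (hy : ∀ l ∈ bl, l.count y ≤ 1) (hz : ∀ l ∈ bl, l.count z ≤ 1) (a b : ℕ)
    (h : (List.replicate a y ++ List.replicate b z).Sublist bl.flatten) : a + b ≤ bl.length + 1 := by
  obtain ⟨l1, l2, h1, h2, h3⟩ := List.append_sublist_iff.1 h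
  rw [List.replicate_sublist_iff] at h2 h3
  have := block_bound y z bl hy hz l1 l2 h1.symm
  omega

lemma sub_left_of {α : Type*} (s l1 l2 : List α) (z : α) (b : ℕ) (hb : 1 ≤ b) (hz : z ∉ l2)
    (h : (s ++ List.replicate b z).Sublist (l1 ++ l2)) : (s ++ List.replicate b z).Sublist l1 := by
  obtain ⟨s1, s2, hs, h1, h2⟩ := List.sublist_append_iff.1 h
  rcases List.eq_nil_or_concat s2 with rfl | ⟨s2', t, rfl⟩
  · rw [hs]; simpa using h1
  · exfalso
    obtain ⟨b, rfl⟩ : ∃ i, b = i + 1 := ⟨b - 1, by omega⟩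
    rw [List.replicate_succ', ← List.append_assoc, List.concat_eq_append, ← List.append_assoc] at hs
    have := List.append_inj_right' hs rfl
    have : z = t := by simpa using this
    subst this
    exact hz (h2.subset (by simp))

lemma sub_right_of {α : Type*} (s l1 l2 : List α) (y : α) (a : ℕ) (ha : 1 ≤ a) (hy : y ∉ l1)
    (h : (List.replicate a y ++ s).Sublist (l1 ++ l2)) : (List.replicate a y ++ s).Sublist l2 := by
  have h1 := h.reverse
  rw [List.reverse_append, List.reverse_append, List.reverse_replicate] at h1
  have h2 := (sub_left_of _ _ _ y a ha (by simpa using hy) h1).reverse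
  simpa using h2

lemma count_asc_le (K : ℕ) (f : ℕ → Lt) (hf : f.Injective) (y : Lt) : (asc K f).count y ≤ 1 := by
  apply List.nodup_iff_count_le_one.1
  exact List.nodup_range.map hf

lemma b_inj : Function.Injective Lt.b := by intro i j h; simpa using h
lemma c_inj : Function.Injective Lt.c := by intro i j h; simpa using h

lemma count_b_asc_c (K i : ℕ) : (asc K Lt.c).count (Lt.b i) = 0 := by
  rw [List.count_eq_zero, mem_asc]; simp
lemma count_c_asc_b (K i : ℕ) : (asc K Lt.b).count (Lt.c i) = 0 := by
  rw [List.count_eq_zero, mem_asc]; simp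
lemma count_x_asc_b (K : ℕ) : (asc K Lt.b).count Lt.x = 0 := by
  rw [List.count_eq_zero, mem_asc]; simp
lemma count_x_asc_c (K : ℕ) : (asc K Lt.c).count Lt.x = 0 := by
  rw [List.count_eq_zero, mem_asc]; simp

lemma c_not_mem_u (r K i : ℕ) : Lt.c i ∉ uW r K := by
  intro h
  rw [uW, List.mem_append] at h
  rcases h with h | h
  · have := mem_pre h
    simp [mem_asc] at this
  · simp [mem_asc] at h

lemma b_not_mem_v (K i : ℕ) : Lt.b i ∉ vW K := by
  simp [vW, mem_asc]

lemma count_c_u (r K i : ℕ) : (uW r K).count (Lt.c i) = 0 :=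
  List.count_eq_zero.2 (c_not_mem_u r K i)
lemma count_b_v (K i : ℕ) : (vW K).count (Lt.b i) = 0 :=
  List.count_eq_zero.2 (b_not_mem_v K i)

lemma WW_le (r K j : ℕ) : (WW r K 0).Sublist (WW r K j) := by
  simp only [WW, List.replicate_zero, List.nil_append, List.append_sublist_append_left]
  exact List.sublist_append_right _ _

lemma WW_no_x (r K j : ℕ) (s : List Lt) (hs : Lt.x ∉ s) (h : s.Sublist (WW r K j)) :
    s.Sublist (WW r K 0) := by
  have h1 := h.filter (fun t => decide (t ≠ Lt.x))
  rw [List.filter_eq_self.2 (by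
    intro t ht
    have : t ≠ Lt.x := by rintro rfl; exact hs ht
    simpa using this)] at h1
  have e : (WW r K j).filter (fun t => decide (t ≠ Lt.x)) =
      (WW r K 0).filter (fun t => decide (t ≠ Lt.x)) := by
    simp [WW, List.filter_append, List.filter_replicate]
  rw [e] at h1
  exact h1.trans List.filter_sublist

lemma blocks_u (r K : ℕ) : uW r K =
    (List.replicate r (Lt.x :: asc K Lt.b) ++ [Lt.x :: (asc K Lt.b).reverse]).flatten := by
  simp [uW, pre]

lemma blocks_W (r K : ℕ) : WW r K 0 =
    (List.replicate r (Lt.x :: asc K Lt.b) ++ [Lt.x :: (asc K Lt.b).reverse ++ vW K]).flatten := by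
  simp [WW, uW, pre]

lemma blocks_v (K : ℕ) : vW K =
    [asc K Lt.c ++ [Lt.x], (asc K Lt.c).reverse ++ [Lt.x]].flatten := by
  simp [vW]

lemma blocks_W' (r K : ℕ) : WW r K 0 =
    [uW r K ++ asc K Lt.c ++ [Lt.x], (asc K Lt.c).reverse ++ [Lt.x]].flatten := by
  simp [WW, vW]

lemma cnt1 (r K i : ℕ) : ∀ l ∈ (List.replicate r (Lt.x :: asc K Lt.b) ++
    [Lt.x :: (asc K Lt.b).reverse ++ vW K]), l.count (Lt.b i) ≤ 1 := by
  have := count_asc_le K Lt.b b_inj (Lt.b i)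
  intro l hl
  simp only [List.mem_append, List.mem_replicate, List.mem_singleton] at hl
  rcases hl with ⟨_, rfl⟩ | rfl <;> simpa [count_b_v, List.count_cons] using this

lemma cnt2 (r K : ℕ) (y : Lt) (hy : y = Lt.x ∨ ∃ i, y = Lt.b i) :
    ∀ l ∈ (List.replicate r (Lt.x :: asc K Lt.b) ++
    [Lt.x :: (asc K Lt.b).reverse]), l.count y ≤ 1 := by
  have := count_asc_le K Lt.b b_inj y
  intro l hl
  simp only [List.mem_append, List.mem_replicate, List.mem_singleton] at hl
  rcases hy with rfl | ⟨i, rfl⟩ <;>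
  rcases hl with ⟨_, rfl⟩ | rfl <;> simpa [List.count_cons, count_x_asc_b] using this

lemma cnt3 (K : ℕ) (y : Lt) (hy : y = Lt.x ∨ ∃ i, y = Lt.c i) :
    ∀ l ∈ [asc K Lt.c ++ [Lt.x], (asc K Lt.c).reverse ++ [Lt.x]], l.count y ≤ 1 := by
  have := count_asc_le K Lt.c c_inj y
  intro l hl
  simp only [List.mem_cons, List.not_mem_nil, or_false] at hl
  rcases hy with rfl | ⟨i, rfl⟩ <;>
  rcases hl with rfl | rfl <;> simpa [List.count_cons, count_x_asc_c] using this

lemma cnt4 (r K i : ℕ) : ∀ l ∈ [uW r K ++ asc K Lt.c ++ [Lt.x], (asc K Lt.c).reverse ++ [Lt.x]],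
    l.count (Lt.c i) ≤ 1 := by
  have := count_asc_le K Lt.c c_inj (Lt.c i)
  intro l hl
  simp only [List.mem_cons, List.not_mem_nil, or_false] at hl
  rcases hl with rfl | rfl <;> simpa [List.count_cons, count_c_u] using this

def Good (r K : ℕ) (y z : Lt) : Prop := ∀ j a b : ℕ, 1 ≤ a → 1 ≤ b →
  (List.replicate a y ++ List.replicate b z).Sublist (WW r K j) →
    a + b ≤ r + 2 ∧ (List.replicate a y ++ List.replicate b z).Sublist (WW r K 0)

lemma good_bb (r K i i' : ℕ) : Good r K (Lt.b i) (Lt.b i') := by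
  intro j a b ha hb h
  have h0 := WW_no_x r K j _ (by simp [List.mem_replicate]) h
  refine ⟨?_, h0⟩
  rw [blocks_W] at h0
  have := block_bound' _ _ _ (cnt1 r K i) (cnt1 r K i') a b h0
  simp at this; omega

lemma good_cc (r K i i' : ℕ) (hr : 1 ≤ r) : Good r K (Lt.c i) (Lt.c i') := by
  intro j a b ha hb h
  have h0 := WW_no_x r K j _ (by simp [List.mem_replicate]) h
  refine ⟨?_, h0⟩
  rw [blocks_W'] at h0
  have := block_bound' _ _ _ (cnt4 r K i) (cnt4 r K i') a b h0
  simp at this; omega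

lemma good_xb (r K i : ℕ) : Good r K Lt.x (Lt.b i) := by
  intro j a b ha hb h
  have h0 := sub_left_of _ _ _ _ b hb (by simp [b_not_mem_v, List.mem_replicate]) h
  refine ⟨?_, h0.trans (List.sublist_append_left _ _)⟩
  rw [blocks_u] at h0
  have := block_bound' _ _ _ (cnt2 r K _ (Or.inl rfl)) (cnt2 r K _ (Or.inr ⟨i, rfl⟩)) a b h0
  simp at this; omega

lemma good_cx (r K i : ℕ) (hr : 1 ≤ r) : Good r K (Lt.c i) Lt.x := by
  intro j a b ha hb h
  have h0 := sub_right_of _ _ _ _ a ha (c_not_mem_u r K i) h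
  have h1 := sub_right_of _ _ _ _ a ha (by simp [List.mem_replicate]) h0
  refine ⟨?_, h1.trans ((List.sublist_append_right _ _).trans (List.sublist_append_right _ _))⟩
  rw [blocks_v] at h1
  have := block_bound' _ _ _ (cnt3 K _ (Or.inr ⟨i, rfl⟩)) (cnt3 K _ (Or.inl rfl)) a b h1
  simp at this; omega

lemma good_cb (r K i i' : ℕ) : Good r K (Lt.c i) (Lt.b i') := by
  intro j a b ha hb h
  exfalso
  have h0 := sub_right_of _ _ _ _ a ha (c_not_mem_u r K i) h
  have : Lt.b i' ∈ List.replicate j Lt.x ++ vW K := h0.subset (by simp [List.mem_replicate]; omega)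
  simp [b_not_mem_v, List.mem_replicate] at this

lemma good_or (r K : ℕ) (hr : 1 ≤ r) (y z : Lt) (hyz : y ≠ z) : Good r K y z ∨ Good r K z y := by
  rcases y with _ | i | i <;> rcases z with _ | i' | i'
  · exact absurd rfl hyz
  · exact Or.inl (good_xb r K i')
  · exact Or.inr (good_cx r K i' hr)
  · exact Or.inr (good_xb r K i)
  · exact Or.inl (good_bb r K i i')
  · exact Or.inr (good_cb r K i' i)
  · exact Or.inl (good_cx r K i hr)
  · exact Or.inl (good_cb r K i i')
  · exact Or.inl (good_cc r K i i' hr)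

lemma rigid (n r K : ℕ) (hn : n = r + 3) (hr : 1 ≤ r) (w : List Lt) (h1 : SubLe n (WW r K 0) w)
    (h2 : SubLe n w (WW r K 0)) : ∃ j, w = WW r K j := by
  have cx : ∀ j, (WW r K j).count Lt.x = n + j := by
    intro j
    have e : (pre r K Lt.b).count Lt.x = r := by
      simp [pre, List.count_flatten, count_x_asc_b]
    simp [WW, uW, vW, e, count_x_asc_b, count_x_asc_c]
    omega
  have hxw : n ≤ w.count Lt.x := by
    rw [← List.replicate_sublist_iff]
    apply h1 _ (by simp)
    rw [List.replicate_sublist_iff, cx]; omega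
  have cy : ∀ y, y ≠ Lt.x → w.count y = (WW r K 0).count y := by
    intro y hy
    have hb : (WW r K 0).count y < n := by
      rcases y with _ | i | i
      · exact absurd rfl hy
      · have := count_flatten_le _ _ (cnt1 r K i)
        rw [← blocks_W] at this
        simp at this; omega
      · have := count_flatten_le _ _ (cnt4 r K i)
        rw [← blocks_W'] at this
        simp at this; omega
    apply le_antisymm
    · by_contra hc
      have := h2 (List.replicate ((WW r K 0).count y + 1) y) (by simp; omega)
        (by rw [List.replicate_sublist_iff]; omega)
      rw [List.replicate_sublist_iff] at this
      omega
    · rw [← List.replicate_sublist_iff]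
      apply h1 _ (by simp; omega)
      rw [List.replicate_sublist_iff]
  have cj : ∀ j y, y ≠ Lt.x → (WW r K j).count y = (WW r K 0).count y := by
    intro j y hy
    simp [WW, List.count_replicate, hy.symm]
  refine ⟨w.count Lt.x - n, ?_⟩
  have main : ∀ j y z, Good r K y z → ∀ a b : ℕ, 1 ≤ a → 1 ≤ b →
      ((List.replicate a y ++ List.replicate b z).Sublist w ↔
        (List.replicate a y ++ List.replicate b z).Sublist (WW r K j)) := by
    intro j y z hg a b ha hb
    constructor
    · intro h
      by_cases hab : a + b ≤ n
      · exact (h2 _ (by simpa using hab) h).trans (WW_le r K j)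
      · exfalso
        have hs : (List.replicate (min a (n - 1)) y ++
            List.replicate (n - min a (n - 1)) z).Sublist w := by
          refine List.Sublist.trans (List.Sublist.append ?_ ?_) h
          · rw [List.replicate_sublist_replicate]; omega
          · rw [List.replicate_sublist_replicate]; omega
        have := (hg 0 _ _ (by omega) (by omega) (h2 _ (by simp <;> omega) hs)).1
        omega
    · intro h
      have := hg j a b ha hb h
      exact h1 _ (by simp; omega) this.2
  apply orient_det
  · intro y
    by_cases hy : y = Lt.x
    · subst hy; rw [cx]; omega
    · rw [cy y hy, cj (w.count Lt.x - n) y hy]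
  · intro y z hyz
    rcases good_or r K hr y z hyz with hg | hg
    · exact Or.inl (main _ y z hg)
    · exact Or.inr (main _ z y hg)

/-! ### Assembly -/

lemma isoterm {X : Type} (n r K : ℕ) (hn : n = r + 3) (hr : 1 ≤ r) (θ : X → List Lt) (p q : List X)
    (hK : p.length + 4 < K) (hpq : SubLe n p q) (hqp : SubLe n q p) (a b : List Lt)
    (h : a ++ p.flatMap θ ++ b = WW r K 0) : a ++ q.flatMap θ ++ b = WW r K 0 := by
  let θ' : X ⊕ Bool → List Lt := Sum.elim θ (fun e => if e then b else a)
  let ext : List X → List (X ⊕ Bool) := fun l =>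
    [Sum.inr false] ++ l.flatMap (fun t => [Sum.inl t]) ++ [Sum.inr true]
  have hext : ∀ l, (ext l).flatMap θ' = a ++ l.flatMap θ ++ b := by
    intro l
    simp [ext, θ', List.flatMap_assoc]
  have hrefl : ∀ l : List (X ⊕ Bool), SubLe n l l := fun l s _ h => h
  have e1 : SubLe n (ext p) (ext q) := ((hrefl _).append (hpq.flatMap _)).append (hrefl _)
  have e2 : SubLe n (ext q) (ext p) := ((hrefl _).append (hqp.flatMap _)).append (hrefl _)
  have hp : (ext p).flatMap θ' = WW r K 0 := by rw [hext, h]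
  obtain ⟨j, hj⟩ := rigid n r K hn hr ((ext q).flatMap θ') (by rw [← hp]; exact e1.flatMap θ')
    (by rw [← hp]; exact e2.flatMap θ')
  have := not_insert n r K j (by omega) θ' (ext p) (ext q)
    (by simp [ext]; omega) e1 e2 hp hj
  rw [← hext, hj, this]

/-- The syntactic congruence of a word. -/
def synCon (W : FreeMonoid Lt) : Con (FreeMonoid Lt) where
  r u v := ∀ a b, a * u * b = W ↔ a * v * b = W
  iseqv := ⟨fun _ _ _ => Iff.rfl, fun h a b => (h a b).symm, fun h h' a b => (h a b).trans (h' a b)⟩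
  mul' := by
    intro u v u' v' h h' a b
    have h1 := h a (u' * b)
    have h2 := h' (a * v) b
    simp only [mul_assoc] at h1 h2 ⊢
    exact h1.trans h2

/-- For `n ≥ 4`, the identities of the stylic monoid `Styl_n` admit no finite basis:
for every finite set `Δ` of monoid identities each holding in `Styl_n`, there is an
identity `w = w'` holding in `Styl_n` but not following from `Δ`, i.e., some monoid
satisfies all identities of `Δ` but fails `w = w'`. -/
theorem styl_no_finite_basis (n : ℕ) (hn : 4 ≤ n) (X : Type)
    (Δ : Finset (FreeMonoid X × FreeMonoid X))
    (hΔ : ∀ p ∈ Δ, ∀ φ : FreeMonoid X →* Styl n, φ p.1 = φ p.2) :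
    ∃ (Y : Type) (w w' : FreeMonoid Y),
      (∀ φ : FreeMonoid Y →* Styl n, φ w = φ w') ∧
      ∃ (M : Type) (_ : Monoid M),
        (∀ p ∈ Δ, ∀ φ : FreeMonoid X →* M, φ p.1 = φ p.2) ∧
        ∃ φ : FreeMonoid Y →* M, φ w ≠ φ w' := by
  classical
  obtain ⟨r, rfl⟩ : ∃ r, n = r + 3 := ⟨n - 3, by omega⟩
  let K := (∑ p ∈ Δ, (p.1.toList.length + p.2.toList.length)) + 5
  let W : FreeMonoid Lt := FreeMonoid.ofList (WW r K 0)
  refine ⟨Lt, W, FreeMonoid.ofList (WW r K 1), fun φ => (styl_identity _ r K rfl φ).symm,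
    (synCon W).Quotient, inferInstance, ?_, (synCon W).mk', ?_⟩
  · intro p hp φ
    have hlen : p.1.toList.length + p.2.toList.length + 4 < K := by
      have := Finset.single_le_sum
        (f := fun p : FreeMonoid X × FreeMonoid X => p.1.toList.length + p.2.toList.length)
        (fun _ _ => Nat.zero_le _) hp
      show _ < (∑ p ∈ Δ, (p.1.toList.length + p.2.toList.length)) + 5
      omega
    have h12 := subLe_of_identity (r + 3) p.1 p.2 (hΔ p hp)
    have h21 := subLe_of_identity (r + 3) p.2 p.1 (fun φ => (hΔ p hp φ).symm)
    choose θ hθ using fun y : X => Con.mk'_surjective (c := synCon W) (φ (FreeMonoid.of y))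
    have key : ∀ l : List X, φ (FreeMonoid.ofList l) =
        (synCon W).mk' (FreeMonoid.ofList (l.flatMap (fun t => (θ t).toList))) := by
      intro l
      induction l with
      | nil => simp
      | cons y l ih =>
        rw [FreeMonoid.ofList_cons, map_mul, ih, ← hθ, List.flatMap_cons, FreeMonoid.ofList_append,
          map_mul]
        simp
    have k1 := key p.1.toList
    have k2 := key p.2.toList
    rw [FreeMonoid.ofList_toList] at k1 k2
    rw [k1, k2]
    refine (Con.eq _).2 ?_
    intro a b
    constructor
    · intro h
      exact isoterm (r + 3) r K rfl (by omega) (fun t => (θ t).toList) p.1.toList p.2.toList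
        (by omega) h12 h21 a.toList b.toList h
    · intro h
      exact isoterm (r + 3) r K rfl (by omega) (fun t => (θ t).toList) p.2.toList p.1.toList
        (by omega) h21 h12 a.toList b.toList h
  · intro h
    have h1 := (Con.eq _).1 h
    have h2 := (h1 1 1).1 (by simp [W])
    have h3 := congrArg (fun w : FreeMonoid Lt => w.toList.length) h2
    simp [W, WW] at h3
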